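/- Two DAGs G and G' on Fin p are Markov equivalent if and only if their characteristic imsets agree, i.e., c_G(A) = c_{G'}(A) for every subset A ⊆ Fin p with |A| ≥ 2. -/

import Mathlib

namespace CausalDiscovery

variable {V : Type*}

/-- A relation is acyclic if it has no directed cycles. -/
def Acyclic (E : V → V → Prop) : Prop :=
  ∀ v, ¬ Relation.TransGen E v v

/-- `i` and `j` are adjacent (joined by an edge in either direction). -/
def Adj (E : V → V → Prop) (i j : V) : Prop :=
  E i j ∨ E j i

/-- `j` is a descendant of `i`, i.e. reachable from `i` by a directed path. -/
def Desc (E : V → V → Prop) (i j : V) : Prop :=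
  Relation.ReflTransGen E i j

/-- `f 0, f 1, …, f n` is a path between `i` and `j`: the vertices are distinct and
consecutive vertices are adjacent. -/
def IsPath (E : V → V → Prop) (n : ℕ) (f : ℕ → V) (i j : V) : Prop :=
  0 < n ∧ f 0 = i ∧ f n = j ∧
    (∀ s t, s ≤ n → t ≤ n → f s = f t → s = t) ∧
    ∀ t, t < n → Adj E (f t) (f (t + 1))

/-- The vertex at (interior) position `t` of the path `f` is a collider:
both edges of the path at that vertex point into it. -/
def ColliderAt (E : V → V → Prop) (f : ℕ → V) (t : ℕ) : Prop :=
  E (f (t - 1)) (f t) ∧ E (f (t + 1)) (f t)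

/-- The path `f 0, …, f n` d-connects its endpoints given `C`: every non-collider
interior vertex is outside `C`, every collider is in `C` or has a descendant in `C`. -/
def DConn (E : V → V → Prop) (n : ℕ) (f : ℕ → V) (C : Finset V) : Prop :=
  ∀ t, 0 < t → t < n →
    (ColliderAt E f t → f t ∈ C ∨ ∃ d ∈ C, Desc E (f t) d) ∧
    (¬ ColliderAt E f t → f t ∉ C)

/-- `i` and `j` are d-separated given `C`: no path between them d-connects given `C`. -/
def DSep (E : V → V → Prop) (i j : V) (C : Finset V) : Prop :=
  ∀ n f, IsPath E n f i j → ¬ DConn E n f C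

/-- The independence model `I(E)`: all d-separation triples `(i, j, C)` with `i, j`
distinct and `C ⊆ V \ {i, j}`. -/
def Indep (E : V → V → Prop) : Set (V × V × Finset V) :=
  {x | x.1 ≠ x.2.1 ∧ x.1 ∉ x.2.2 ∧ x.2.1 ∉ x.2.2 ∧ DSep E x.1 x.2.1 x.2.2}

/-- Two graphs are Markov equivalent if they have the same independence model. -/
def MarkovEquiv (E E' : V → V → Prop) : Prop :=
  Indep E = Indep E'

/-- Two graphs have the same skeleton if they have the same adjacencies. -/
def SameSkeleton (E E' : V → V → Prop) : Prop :=
  ∀ i j, Adj E i j ↔ Adj E' i j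

/-- The v-structures of a graph: triples `(i, j, k)` with `i → j ← k` and `i, k`
not adjacent. -/
def VStruct (E : V → V → Prop) : Set (V × V × V) :=
  {x | E x.1 x.2.1 ∧ E x.2.2 x.2.1 ∧ x.1 ≠ x.2.2 ∧ ¬ Adj E x.1 x.2.2}


open Classical in
/-- The parent set `pa(j) = {i : i → j}` as a `Finset`. -/
noncomputable def parents {p : ℕ} (E : Fin p → Fin p → Prop) (j : Fin p) :
    Finset (Fin p) :=
  Finset.univ.filter fun i => E i j

open Classical in
/-- The characteristic imset of a DAG: `c_G(A) = 1` if there exists `i ∈ A` with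
`A \ {i} ⊆ pa(i)`, and `c_G(A) = 0` otherwise. -/
noncomputable def charImset {p : ℕ} (E : Fin p → Fin p → Prop)
    (A : Finset (Fin p)) : ℤ :=
  if ∃ i ∈ A, A \ {i} ⊆ parents E i then 1 else 0

section Graph

variable {E E' : V → V → Prop} {C : Finset V}

theorem Adj.symm {i j : V} (h : Adj E i j) : Adj E j i :=
  Or.symm h

theorem Acyclic.irrefl (hE : Acyclic E) (a : V) : ¬ E a a :=
  fun h => hE a (.single h)

theorem Acyclic.asymm (hE : Acyclic E) {a b : V} (h : E a b) : ¬ E b a :=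
  fun h' => hE a (.tail (.single h) h')

theorem Acyclic.not_three_cycle (hE : Acyclic E) {a b c : V} (h : E a b) (h' : E b c) :
    ¬ E c a :=
  fun h'' => hE a (.tail (.tail (.single h) h') h'')

theorem Acyclic.ne_of_adj (hE : Acyclic E) {a b : V} (h : Adj E a b) : a ≠ b := by
  rintro rfl
  exact hE.irrefl a (h.elim id id)

/-- In a finite acyclic graph every nonempty set of vertices has a sink. -/
theorem Acyclic.exists_sink [Finite V] (hE : Acyclic E) {S : Set V} (hS : S.Nonempty) :
    ∃ m ∈ S, ∀ x ∈ S, ¬ E m x := by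
  let r : V → V → Prop := fun a b => Relation.TransGen E b a
  have : IsTrans V r := ⟨fun _ _ _ h h' => h'.trans h⟩
  have : Std.Irrefl r := ⟨fun a h => hE a h⟩
  obtain ⟨m, hm, h⟩ := (Finite.wellFounded_of_trans_of_irrefl r).has_min S hS
  exact ⟨m, hm, fun x hx hmx => h x hx (.single hmx)⟩

/-- The interior path vertex `b` with neighbours `a` and `c` does not block the path. -/
def Active (E : V → V → Prop) (C : Finset V) (a b c : V) : Prop :=
  (E a b ∧ E c b → ∃ d ∈ C, Desc E b d) ∧ (¬ (E a b ∧ E c b) → b ∉ C)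

theorem Active.symm {a b c : V} (h : Active E C a b c) : Active E C c b a :=
  ⟨fun h' => h.1 h'.symm, fun h' => h.2 fun h'' => h' h''.symm⟩

theorem dConn_iff {n : ℕ} {f : ℕ → V} :
    DConn E n f C ↔ ∀ t, t + 1 < n → Active E C (f t) (f (t + 1)) (f (t + 2)) := by
  constructor
  · intro h t ht
    obtain ⟨h₁, h₂⟩ := h (t + 1) (by omega) ht
    refine ⟨fun hc => ?_, fun hc => h₂ hc⟩
    rcases h₁ hc with h | h
    · exact ⟨_, h, .refl⟩
    · exact h
  · intro h t ht0 ht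
    obtain ⟨t, rfl⟩ : ∃ s, t = s + 1 := ⟨t - 1, by omega⟩
    exact ⟨fun hc => .inr ((h t ht).1 hc), fun hc => (h t ht).2 hc⟩

/-- Replacing the segment of a d-connecting path between two adjacent vertices `f s` and `f t`
by the edge joining them gives a shorter d-connecting path. -/
theorem exists_shorter_dConn {n s t : ℕ} {f : ℕ → V} {i j : V} (hf : IsPath E n f i j)
    (hC : DConn E n f C) (hst : s + 1 < t) (htn : t ≤ n) (hadj : Adj E (f s) (f t))
    (hs : 0 < s → Active E C (f (s - 1)) (f s) (f t))
    (ht : t < n → Active E C (f s) (f t) (f (t + 1))) :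
    ∃ m < n, ∃ g, IsPath E m g i j ∧ DConn E m g C := by
  obtain ⟨hn, h0, hl, hinj, hstep⟩ := hf
  rw [dConn_iff] at hC
  obtain ⟨k, rfl⟩ : ∃ k, t = s + 1 + k := ⟨t - s - 1, by omega⟩
  have hk : 0 < k := by omega
  let g : ℕ → V := fun x => if x ≤ s then f x else f (x + k)
  have g1 : ∀ x, x ≤ s → g x = f x := fun x hx => if_pos hx
  have g2 : ∀ x, s < x → g x = f (x + k) := fun x hx => if_neg (by omega)
  refine ⟨n - k, by omega, g, ⟨by omega, ?_, ?_, ?_, ?_⟩, ?_⟩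
  · rw [g1 0 (by omega), h0]
  · rw [g2 _ (by omega), Nat.sub_add_cancel (by omega), hl]
  · intro x y hx hy hxy
    rcases le_or_gt x s with h | h <;> rcases le_or_gt y s with h' | h'
    · rw [g1 x h, g1 y h'] at hxy
      exact hinj _ _ (by omega) (by omega) hxy
    · rw [g1 x h, g2 y h'] at hxy
      have := hinj _ _ (by omega) (by omega) hxy
      omega
    · rw [g2 x h, g1 y h'] at hxy
      have := hinj _ _ (by omega) (by omega) hxy
      omega
    · rw [g2 x h, g2 y h'] at hxy
      have := hinj _ _ (by omega) (by omega) hxy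
      omega
  · intro x hx
    rcases lt_trichotomy x s with h | rfl | h
    · rw [g1 x h.le, g1 _ h]
      exact hstep x (by omega)
    · rw [g1 x le_rfl, g2 _ (by omega)]
      exact hadj
    · rw [g2 x h, g2 _ (by omega), show x + 1 + k = x + k + 1 by omega]
      exact hstep _ (by omega)
  · rw [dConn_iff]
    intro x hx
    rcases lt_trichotomy (x + 1) s with h | h | h
    · rw [g1 x (by omega), g1 (x + 1) (by omega), g1 (x + 2) (by omega)]
      exact hC x (by omega)
    · rw [g1 x (by omega), g1 (x + 1) (by omega), g2 (x + 2) (by omega)]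
      have := hs (by omega)
      subst h
      rw [show x + 1 + 1 + k = x + 2 + k by omega] at this
      exact this
    · rcases eq_or_lt_of_le (Nat.lt_succ_iff.mp h) with h | h
      · subst h
        rw [g1 s (by omega), g2 (s + 1) (by omega), g2 (s + 2) (by omega)]
        have := ht (by omega)
        rw [show s + 1 + k + 1 = s + 2 + k by omega] at this
        exact this
      · rw [g2 x (by omega), g2 (x + 1) (by omega), g2 (x + 2) (by omega),
          show x + 1 + k = x + k + 1 by omega, show x + 2 + k = x + k + 2 by omega]
        exact hC _ (by omega)

/-- The head of a chord `a → c` over `b` stays active when `b` is skipped. -/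
theorem Active.skip_head (hE : Acyclic E) {a b c d : V} (hac : E a c) (hab : Adj E a b)
    (hbc : Adj E b c) (hb : Active E C a b c) (hc : Active E C b c d) : Active E C a c d := by
  rcases hbc with hbc | hcb
  · exact ⟨fun h => hc.1 ⟨hbc, h.2⟩, fun h => hc.2 fun h' => h ⟨hac, h'.2⟩⟩
  · have hab' : E a b := hab.resolve_right fun h => hE.not_three_cycle hac hcb h
    obtain ⟨e, he, hbe⟩ := hb.1 ⟨hab', hcb⟩
    exact ⟨fun _ => ⟨e, he, .head hcb hbe⟩, fun _ => hc.2 fun h => hE.asymm hcb h.1⟩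

/-- The tail of a chord `a → c` over `b` stays active when `b` is skipped, unless `a` is a
collider. -/
theorem Active.skip_tail (hE : Acyclic E) {a b c z : V} (hac : E a c)
    (ha : Active E C z a b) : Active E C z a c ∨ (E z a ∧ E b a) := by
  by_cases h : E z a ∧ E b a
  · exact .inr h
  · exact .inl ⟨fun h' => absurd h'.2 (hE.asymm hac), fun _ => ha.2 h⟩

/-- A vertex with an outgoing path edge stays active if that edge is replaced by another
outgoing one. -/
theorem Active.replace_tail (hE : Acyclic E) {a b d z : V} (hab : E a b) (had : E a d)
    (ha : Active E C z a b) : Active E C z a d :=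
  ⟨fun h => absurd h.2 (hE.asymm had), fun _ => ha.2 fun h => hE.asymm hab h.2⟩

/-- On a shortest d-connecting path, a shielded interior vertex is a non-collider pointing
towards a neighbouring collider. -/
theorem shielded_of_shortest (hE : Acyclic E) {n : ℕ} {f : ℕ → V} {i j : V}
    (hf : IsPath E n f i j) (hC : DConn E n f C)
    (hmin : ∀ m < n, ∀ g, IsPath E m g i j → ¬ DConn E m g C)
    {t : ℕ} (ht : t + 1 < n) (hadj : Adj E (f t) (f (t + 2))) :
    (0 < t ∧ E (f (t - 1)) (f t) ∧ E (f (t + 1)) (f t)) ∨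
      (t + 2 < n ∧ E (f (t + 1)) (f (t + 2)) ∧ E (f (t + 3)) (f (t + 2))) := by
  by_contra hcon
  rw [not_or] at hcon
  obtain ⟨hl, hr⟩ := hcon
  have hA := dConn_iff.mp hC
  have h₁ := hf.2.2.2.2 t (by omega)
  have h₂ := hf.2.2.2.2 (t + 1) (by omega)
  have hshort : (0 < t → Active E C (f (t - 1)) (f t) (f (t + 2))) ∧
      (t + 2 < n → Active E C (f t) (f (t + 2)) (f (t + 3))) := by
    have hleft : 0 < t → Active E C (f (t - 1)) (f t) (f (t + 1)) := fun h0 => by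
      obtain ⟨t, rfl⟩ : ∃ s, t = s + 1 := ⟨t - 1, by omega⟩
      exact hA t (by omega)
    rcases hadj with hac | hca
    · exact ⟨fun h0 => (Active.skip_tail hE hac (hleft h0)).resolve_right fun h => hl ⟨h0, h⟩,
        fun hn => Active.skip_head hE hac h₁ h₂ (hA t ht) (hA (t + 1) (by omega))⟩
    · refine ⟨fun h0 => (Active.skip_head hE hca h₂.symm h₁.symm (hA t ht).symm
        (hleft h0).symm).symm, fun hn => ?_⟩
      refine ((Active.skip_tail hE hca (hA (t + 1) (by omega)).symm).resolve_right ?_).symm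
      exact fun h => hr ⟨hn, h.2, h.1⟩
  obtain ⟨m, hm, g, hg, hgC⟩ :=
    exists_shorter_dConn hf hC (s := t) (t := t + 2) (by omega) (by omega) hadj
      hshort.1 hshort.2
  exact hmin m hm g hg hgC

/-- A shortest d-connecting path has the same colliders in every graph with the same skeleton
and v-structures. -/
theorem collider_iff_of_shortest (hE : Acyclic E) (hE' : Acyclic E') (hS : SameSkeleton E E')
    (hV : VStruct E = VStruct E') {n : ℕ} {f : ℕ → V} {i j : V}
    (hf : IsPath E n f i j) (hC : DConn E n f C)
    (hmin : ∀ m < n, ∀ g, IsPath E m g i j → ¬ DConn E m g C) {t : ℕ} (ht : t + 1 < n) :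
    (E (f t) (f (t + 1)) ∧ E (f (t + 2)) (f (t + 1)) → ¬ Adj E (f t) (f (t + 2))) ∧
    ((E (f t) (f (t + 1)) ∧ E (f (t + 2)) (f (t + 1))) ↔
      (E' (f t) (f (t + 1)) ∧ E' (f (t + 2)) (f (t + 1)))) := by
  have hne : ∀ s, s + 1 < n → f s ≠ f (s + 2) := fun s hs h => by
    have := hf.2.2.2.1 s (s + 2) (by omega) (by omega) h
    omega
  have hun : ∀ s, s + 1 < n → E (f s) (f (s + 1)) → E (f (s + 2)) (f (s + 1)) →
      ¬ Adj E (f s) (f (s + 2)) := fun s hs h₁ h₂ hadj => by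
    rcases shielded_of_shortest hE hf hC hmin hs hadj with ⟨-, -, h⟩ | ⟨-, h, -⟩
    · exact hE.asymm h₁ h
    · exact hE.asymm h₂ h
  have himp : ∀ s, s + 1 < n → E (f s) (f (s + 1)) → E (f (s + 2)) (f (s + 1)) →
      E' (f s) (f (s + 1)) ∧ E' (f (s + 2)) (f (s + 1)) := fun s hs h₁ h₂ => by
    have : (f s, f (s + 1), f (s + 2)) ∈ VStruct E := ⟨h₁, h₂, hne s hs, hun s hs h₁ h₂⟩
    rw [hV] at this
    exact ⟨this.1, this.2.1⟩
  refine ⟨fun h => hun t ht h.1 h.2, fun h => himp t ht h.1 h.2, fun h => ?_⟩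
  by_cases hadj : Adj E (f t) (f (t + 2))
  · rcases shielded_of_shortest hE hf hC hmin ht hadj with ⟨h0, h₁, h₂⟩ | ⟨hn, h₁, h₂⟩
    · obtain ⟨t, rfl⟩ : ∃ s, t = s + 1 := ⟨t - 1, by omega⟩
      exact absurd (himp t (by omega) h₁ h₂).2 (hE'.asymm h.1)
    · exact absurd (himp (t + 1) (by omega) h₁ h₂).1 (hE'.asymm h.2)
  · have : (f t, f (t + 1), f (t + 2)) ∈ VStruct E' :=
      ⟨h.1, h.2, hne t ht, fun h' => hadj ((hS _ _).mpr h')⟩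
    rw [← hV] at this
    exact ⟨this.1, this.2.1⟩

/-- There is a directed walk of length `k` from the vertex into `C`. -/
def Reaches (E : V → V → Prop) (C : Finset V) : ℕ → V → Prop
  | 0, v => v ∈ C
  | k + 1, v => ∃ w, E v w ∧ Reaches E C k w

theorem exists_reaches {v : V} : (∃ k, Reaches E C k v) ↔ ∃ d ∈ C, Desc E v d := by
  constructor
  · rintro ⟨k, h⟩
    induction k generalizing v with
    | zero => exact ⟨v, h, .refl⟩
    | succ k ih =>
      obtain ⟨w, hvw, hw⟩ := h
      obtain ⟨d, hd, hwd⟩ := ih hw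
      exact ⟨d, hd, .head hvw hwd⟩
  · rintro ⟨d, hd, h⟩
    induction h using Relation.ReflTransGen.head_induction_on with
    | refl => exact ⟨0, hd⟩
    | head hvw _ ih =>
      obtain ⟨k, hk⟩ := ih
      exact ⟨k + 1, _, hvw, hk⟩

/-- The length of a shortest directed walk from `v` into `C` (and `0` if there is none). -/
noncomputable def depth (E : V → V → Prop) (C : Finset V) (v : V) : ℕ :=
  sInf {k | Reaches E C k v}

theorem depth_le {k : ℕ} {v : V} (h : Reaches E C k v) : depth E C v ≤ k :=
  Nat.sInf_le h

/-- A shortest directed walk into `C` stays directed in a graph with the same skeleton and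
v-structures if its first edge does. -/
theorem exists_desc_of_shortest (hE : Acyclic E) (hS : SameSkeleton E E')
    (hV : VStruct E = VStruct E') {k : ℕ} {v w : V} (hvw : E v w) (hvw' : E' v w)
    (hw : Reaches E C k w) (hmin : ∀ m, Reaches E C m v → k + 1 ≤ m) :
    ∃ d ∈ C, Desc E' v d := by
  induction k generalizing v w with
  | zero => exact ⟨w, hw, .single hvw'⟩
  | succ k ih =>
    obtain ⟨y, hwy, hy⟩ := hw
    have hwy' : E' w y := by
      rcases (hS w y).mp (.inl hwy) with h | h
      · exact h
      · have : (v, w, y) ∈ VStruct E' := by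
          refine ⟨hvw', h, ?_, fun hadj => ?_⟩
          · rintro (rfl : v = y)
            exact hE.asymm hvw hwy
          · rcases (hS v y).mpr hadj with h | h
            · have := hmin (k + 1) ⟨y, h, hy⟩
              omega
            · exact hE.not_three_cycle hvw hwy h
        rw [← hV] at this
        exact absurd this.2.1 (hE.asymm hwy)
    obtain ⟨d, hd, hwd⟩ := ih hwy hwy' hy fun m hm => by
      have := hmin (m + 1) ⟨w, hvw, hm⟩
      omega
    exact ⟨d, hd, .head hvw' hwd⟩

/-- Replacing a collider by a common child of its neighbours that lies off the path keeps a
path d-connecting. -/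
theorem dConn_update (hE : Acyclic E) {n : ℕ} {f : ℕ → V} {i j d : V}
    (hf : IsPath E n f i j) (hC : DConn E n f C) {t : ℕ} (ht : t + 1 < n)
    (h₁ : E (f t) (f (t + 1))) (h₂ : E (f (t + 2)) (f (t + 1)))
    (hd₁ : E (f t) d) (hd₂ : E (f (t + 2)) d) (hd : ∃ e ∈ C, Desc E d e)
    (hoff : ∀ s ≤ n, f s ≠ d) :
    IsPath E n (Function.update f (t + 1) d) i j ∧
      DConn E n (Function.update f (t + 1) d) C := by
  obtain ⟨hn, h0, hl, hinj, hstep⟩ := hf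
  rw [dConn_iff] at hC
  set g := Function.update f (t + 1) d with hg
  have g1 : g (t + 1) = d := Function.update_self ..
  have g2 : ∀ x, x ≠ t + 1 → g x = f x := fun x hx => Function.update_of_ne hx ..
  refine ⟨⟨hn, ?_, ?_, ?_, ?_⟩, ?_⟩
  · rw [g2 _ (by omega), h0]
  · rw [g2 _ (by omega), hl]
  · intro x y hx hy hxy
    by_cases h : x = t + 1 <;> by_cases h' : y = t + 1
    · omega
    · rw [h, g1, g2 y h'] at hxy
      exact absurd hxy.symm (hoff y hy)
    · rw [h', g1, g2 x h] at hxy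
      exact absurd hxy (hoff x hx)
    · rw [g2 x h, g2 y h'] at hxy
      exact hinj _ _ hx hy hxy
  · intro x hx
    by_cases h : x = t + 1
    · subst h
      rw [g1, g2 _ (by omega)]
      exact .inr hd₂
    · by_cases h' : x = t
      · subst h'
        rw [g1, g2 _ (by omega)]
        exact .inl hd₁
      · rw [g2 _ h, g2 _ (by omega)]
        exact hstep x hx
  · rw [dConn_iff]
    intro x hx
    by_cases hxt : x + 1 = t
    · subst hxt
      rw [g2 x (by omega), g2 (x + 1) (by omega), g1]
      exact (hC x (by omega)).replace_tail hE h₁ hd₁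
    by_cases hxt : x = t
    · subst hxt
      rw [g2 x (by omega), g2 (x + 2) (by omega), g1]
      exact ⟨fun _ => hd, fun h => absurd ⟨hd₁, hd₂⟩ h⟩
    by_cases hxt : x = t + 1
    · subst hxt
      rw [g1, g2 (t + 1 + 1) (by omega), g2 (t + 1 + 2) (by omega)]
      exact ((hC (t + 1) hx).symm.replace_tail hE h₂ hd₂).symm
    · rw [g2 x (by omega), g2 (x + 1) (by omega), g2 (x + 2) (by omega)]
      exact hC x hx

/-- No vertex of a shortest d-connecting path is a common child, in the ancestral set of `C`,
of both neighbours of a collider and a child of that collider. -/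
theorem off_path_of_shortest (hE : Acyclic E) {n : ℕ} {f : ℕ → V} {i j d : V}
    (hf : IsPath E n f i j) (hC : DConn E n f C)
    (hmin : ∀ m < n, ∀ g, IsPath E m g i j → ¬ DConn E m g C) {t : ℕ} (ht : t + 1 < n)
    (h₁ : E (f t) (f (t + 1))) (h₂ : E (f (t + 2)) (f (t + 1))) (hbd : E (f (t + 1)) d)
    (hd₁ : E (f t) d) (hd₂ : E (f (t + 2)) d) (hd : ∃ e ∈ C, Desc E d e) :
    ∀ s ≤ n, f s ≠ d := by
  rintro s hs rfl
  have hA := dConn_iff.mp hC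
  have hst : s ≠ t := by rintro rfl; exact hE.irrefl _ hd₁
  have hst₁ : s ≠ t + 1 := by rintro rfl; exact hE.irrefl _ hbd
  have hst₂ : s ≠ t + 2 := by rintro rfl; exact hE.irrefl _ hd₂
  rcases lt_or_gt_of_ne hst with h | h
  · obtain ⟨m, hm, g, hg, hgC⟩ :=
      exists_shorter_dConn hf hC (s := s) (t := t + 2) (by omega) (by omega) (.inr hd₂)
        (fun h0 => by
          obtain ⟨s, rfl⟩ : ∃ r, s = r + 1 := ⟨s - 1, by omega⟩
          exact ⟨fun _ => hd, fun h => (hA s (by omega)).2 fun h' => h ⟨h'.1, hd₂⟩⟩)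
        (fun hn => ((hA (t + 1) (by omega)).symm.replace_tail hE h₂ hd₂).symm)
    exact hmin m hm g hg hgC
  · obtain ⟨m, hm, g, hg, hgC⟩ :=
      exists_shorter_dConn hf hC (s := t) (t := s) (by omega) (by omega) (.inl hd₁)
        (fun h0 => by
          obtain ⟨t, rfl⟩ : ∃ r, t = r + 1 := ⟨t - 1, by omega⟩
          exact (hA t (by omega)).replace_tail hE h₁ hd₁)
        (fun hn => by
          obtain ⟨s, rfl⟩ : ∃ r, s = r + 1 := ⟨s - 1, by omega⟩
          exact ⟨fun _ => hd, fun h => (hA s (by omega)).2 fun h' => h ⟨hd₁, h'.2⟩⟩)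
    exact hmin m hm g hg hgC

/-- On a shortest d-connecting path of least total depth, colliders are ancestors of `C` in
every graph with the same skeleton and v-structures. -/
theorem exists_desc_of_collider (hE : Acyclic E) (hS : SameSkeleton E E')
    (hV : VStruct E = VStruct E') {n : ℕ} {f : ℕ → V} {i j : V}
    (hf : IsPath E n f i j) (hC : DConn E n f C)
    (hmin : ∀ m < n, ∀ g, IsPath E m g i j → ¬ DConn E m g C)
    (hsum : ∀ g, IsPath E n g i j → DConn E n g C →
      ∑ s ∈ Finset.range (n + 1), depth E C (f s) ≤
        ∑ s ∈ Finset.range (n + 1), depth E C (g s))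
    {t : ℕ} (ht : t + 1 < n) (h₁ : E (f t) (f (t + 1))) (h₂ : E (f (t + 2)) (f (t + 1)))
    (hun : ¬ Adj E (f t) (f (t + 2))) :
    ∃ d ∈ C, Desc E' (f (t + 1)) d := by
  have hvs : (f t, f (t + 1), f (t + 2)) ∈ VStruct E := by
    refine ⟨h₁, h₂, fun h => ?_, hun⟩
    have := hf.2.2.2.1 t (t + 2) (by omega) (by omega) h
    omega
  have hvs' := hvs
  rw [hV] at hvs'
  have hreach : Reaches E C (depth E C (f (t + 1))) (f (t + 1)) :=
    Nat.sInf_mem (exists_reaches.mpr ((dConn_iff.mp hC t ht).1 ⟨h₁, h₂⟩))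
  rcases hk : depth E C (f (t + 1)) with _ | k
  · rw [hk] at hreach
    exact ⟨_, hreach, .refl⟩
  rw [hk] at hreach
  obtain ⟨w, hbw, hw⟩ := hreach
  refine exists_desc_of_shortest hE hS hV hbw ?_ hw fun m hm => hk ▸ depth_le hm
  -- a neighbour of the collider not adjacent to `w` forces the edge into `w`
  have key : ∀ a, E a (f (t + 1)) → E' a (f (t + 1)) → ¬ Adj E a w → E' (f (t + 1)) w := by
    intro a ha ha' haw
    rcases (hS _ _).mp (.inl hbw) with h | h
    · exact h
    · have : (a, f (t + 1), w) ∈ VStruct E' := by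
        refine ⟨ha', h, ?_, fun h => haw ((hS _ _).mpr h)⟩
        rintro (rfl : a = w)
        exact hE.asymm ha hbw
      rw [← hV] at this
      exact absurd this.2.1 (hE.asymm hbw)
  by_cases ha : Adj E (f t) w
  · by_cases hc : Adj E (f (t + 2)) w
    · have hd₁ : E (f t) w := ha.resolve_right (hE.not_three_cycle h₁ hbw)
      have hd₂ : E (f (t + 2)) w := hc.resolve_right (hE.not_three_cycle h₂ hbw)
      have hd := exists_reaches.mp ⟨k, hw⟩
      have hoff := off_path_of_shortest hE hf hC hmin ht h₁ h₂ hbw hd₁ hd₂ hd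
      obtain ⟨hg, hgC⟩ := dConn_update hE hf hC ht h₁ h₂ hd₁ hd₂ hd hoff
      refine absurd (hsum _ hg hgC) (not_le.mpr (Finset.sum_lt_sum (fun s _ => ?_)
        ⟨t + 1, Finset.mem_range.mpr (by omega), ?_⟩))
      · by_cases hs : s = t + 1
        · subst hs
          rw [Function.update_self, hk]
          exact (depth_le hw).trans (Nat.le_succ k)
        · rw [Function.update_of_ne hs]
      · rw [Function.update_self, hk]
        exact Nat.lt_succ_of_le (depth_le hw)
    · exact key _ h₂ hvs'.2.1 hc
  · exact key _ h₁ hvs'.1 ha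

/-- d-separation transfers between graphs with the same skeleton and v-structures. -/
theorem dSep_of_dSep (hE : Acyclic E) (hE' : Acyclic E') (hS : SameSkeleton E E')
    (hV : VStruct E = VStruct E') {i j : V} (h : DSep E' i j C) : DSep E i j C := by
  classical
  intro n₀ f₀ hf₀ hC₀
  have hex : ∃ n, ∃ f, IsPath E n f i j ∧ DConn E n f C := ⟨n₀, f₀, hf₀, hC₀⟩
  obtain ⟨f₁, hf₁, hC₁⟩ := Nat.find_spec hex
  have hmin : ∀ m < Nat.find hex, ∀ g, IsPath E m g i j → ¬ DConn E m g C :=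
    fun m hm g hg hgC => Nat.find_min hex hm ⟨g, hg, hgC⟩
  generalize Nat.find hex = n at hf₁ hC₁ hmin
  obtain ⟨f, ⟨hf, hC⟩, hsum⟩ := exists_minimalFor_of_wellFoundedLT
    (fun f : ℕ → V => IsPath E n f i j ∧ DConn E n f C)
    (fun f => ∑ s ∈ Finset.range (n + 1), depth E C (f s)) ⟨f₁, hf₁, hC₁⟩
  have hsum' : ∀ g, IsPath E n g i j → DConn E n g C →
      ∑ s ∈ Finset.range (n + 1), depth E C (f s) ≤
        ∑ s ∈ Finset.range (n + 1), depth E C (g s) :=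
    fun g hg hgC => (le_total _ _).elim id fun hle => hsum ⟨hg, hgC⟩ hle
  refine h n f ⟨hf.1, hf.2.1, hf.2.2.1, hf.2.2.2.1,
    fun t ht => (hS _ _).mp (hf.2.2.2.2 t ht)⟩ (dConn_iff.mpr fun t ht => ?_)
  obtain ⟨hun, hiff⟩ := collider_iff_of_shortest hE hE' hS hV hf hC hmin ht
  constructor
  · intro hc
    have hc := hiff.mpr hc
    exact exists_desc_of_collider hE hS hV hf hC hmin hsum' ht hc.1 hc.2 (hun hc)
  · exact fun hc => (dConn_iff.mp hC t ht).2 fun h => hc (hiff.mp h)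

theorem SameSkeleton.symm (h : SameSkeleton E E') : SameSkeleton E' E :=
  fun i j => (h i j).symm

/-- Acyclic graphs with the same skeleton and v-structures are Markov equivalent. -/
theorem markovEquiv_of_sameSkeleton (hE : Acyclic E) (hE' : Acyclic E')
    (hS : SameSkeleton E E') (hV : VStruct E = VStruct E') : MarkovEquiv E E' := by
  ext ⟨i, j, C⟩
  exact ⟨fun h => ⟨h.1, h.2.1, h.2.2.1, dSep_of_dSep hE' hE hS.symm hV.symm h.2.2.2⟩,
    fun h => ⟨h.1, h.2.1, h.2.2.1, dSep_of_dSep hE hE' hS hV h.2.2.2⟩⟩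

theorem not_dSep_of_adj {i j : V} (hij : i ≠ j) (h : Adj E i j) : ¬ DSep E i j C := by
  intro hs
  refine hs 1 (fun x => if x = 0 then i else j) ⟨one_pos, rfl, rfl, ?_, ?_⟩
    (dConn_iff.mpr fun t ht => by omega)
  · intro s t hs ht h
    interval_cases s <;> interval_cases t <;> simp_all [eq_comm]
  · intro t ht
    interval_cases t
    simpa using h

/-- A separating set of the endpoints of a path `i, k, j` contains `k` unless `k` is a
collider. -/
theorem collider_of_dSep {i j k : V} (hij : i ≠ j) (hik : i ≠ k) (hkj : k ≠ j)
    (h : Adj E i k) (h' : Adj E k j) (hs : DSep E i j C) (hk : k ∉ C) :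
    E i k ∧ E j k := by
  by_contra hc
  let f : ℕ → V := fun x => if x = 0 then i else if x = 1 then k else j
  refine hs 2 f ⟨two_pos, rfl, rfl, ?_, ?_⟩ (dConn_iff.mpr fun t ht => ?_)
  · intro s t hs ht h
    interval_cases s <;> interval_cases t <;> simp_all [f, eq_comm]
  · intro t ht
    interval_cases t
    · exact h
    · exact h'
  · obtain rfl : t = 0 := by omega
    exact ⟨fun h => absurd h hc, fun _ => hk⟩

/-- The parents of `j` d-separate it from every nonadjacent non-descendant. -/
theorem dSep_parents {p : ℕ} {E : Fin p → Fin p → Prop} (hE : Acyclic E) {i j : Fin p}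
    (hadj : ¬ Adj E j i) (hd : ¬ Relation.TransGen E j i) : DSep E j i (parents E j) := by
  rintro n f ⟨hn, rfl, rfl, -, hstep⟩ hC
  rw [dConn_iff] at hC
  have key : ∀ t, t + 1 ≤ n →
      E (f t) (f (t + 1)) ∧ Relation.TransGen E (f 0) (f (t + 1)) := by
    intro t ht
    induction t with
    | zero =>
      have h : E (f 0) (f 1) := by
        refine (hstep 0 hn).resolve_right fun h => ?_
        have hn1 : n ≠ 1 := by
          rintro rfl
          exact hadj (.inr h)
        refine (hC 0 (by omega)).2 (fun h' => hE.asymm h h'.1) ?_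
        simpa [parents] using h
      exact ⟨h, .single h⟩
    | succ t ih =>
      obtain ⟨h, htr⟩ := ih (by omega)
      have h' : E (f (t + 1)) (f (t + 2)) := by
        refine (hstep (t + 1) (by omega)).resolve_right fun h' => ?_
        obtain ⟨d, hd, hdesc⟩ := (hC t (by omega)).1 ⟨h, h'⟩
        have hd : E d (f 0) := by simpa [parents] using hd
        exact hE _ ((htr.trans_left hdesc).tail hd)
      exact ⟨h', htr.tail h'⟩
  have := (key (n - 1) (by omega)).2
  rw [Nat.sub_add_cancel hn] at this
  exact hd this

/-- Nonadjacent vertices are d-separated by the parents of one of them. -/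
theorem mem_indep_of_not_adj {p : ℕ} {E : Fin p → Fin p → Prop} (hE : Acyclic E)
    {i j : Fin p} (hij : i ≠ j) (hadj : ¬ Adj E i j) :
    (i, j, parents E i) ∈ Indep E ∨ (j, i, parents E j) ∈ Indep E := by
  have hp : ∀ a b, a ≠ b → ¬ Adj E a b → ¬ Relation.TransGen E a b →
      (a, b, parents E a) ∈ Indep E := fun a b hab hadj h =>
    ⟨hab, by simpa [parents] using hE.irrefl a,
      by simpa [parents] using fun h => hadj (.inr h), dSep_parents hE hadj h⟩
  by_cases h : Relation.TransGen E i j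
  · exact .inr (hp j i hij.symm (fun h => hadj h.symm) fun h' => hE i (h.trans h'))
  · exact .inl (hp i j hij hadj h)

theorem adj_of_indep_subset {p : ℕ} {E E' : Fin p → Fin p → Prop} (hE : Acyclic E)
    (hE' : Acyclic E') (h : Indep E ⊆ Indep E') {i j : Fin p} (hadj : Adj E' i j) :
    Adj E i j := by
  by_contra hn
  have hij := hE'.ne_of_adj hadj
  rcases mem_indep_of_not_adj hE hij hn with hI | hI
  · exact not_dSep_of_adj hij hadj (h hI).2.2.2
  · exact not_dSep_of_adj hij.symm hadj.symm (h hI).2.2.2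

theorem vStruct_subset_of_indep_subset {p : ℕ} {E E' : Fin p → Fin p → Prop}
    (hE : Acyclic E) (hS : SameSkeleton E E') (h : Indep E ⊆ Indep E') :
    VStruct E ⊆ VStruct E' := by
  rintro ⟨i, k, j⟩ ⟨hik, hjk, hij, hadj⟩
  dsimp only at hik hjk hij hadj
  have hnik := hE.ne_of_adj (.inl hik)
  have hnjk := hE.ne_of_adj (.inl hjk)
  have hik' := (hS _ _).mp (.inl hik)
  have hjk' := (hS _ _).mp (.inl hjk)
  have hp : ∀ a, E a k → k ∉ parents E a := fun a ha => by
    simpa [parents] using hE.asymm ha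
  have hc : E' i k ∧ E' j k := by
    rcases mem_indep_of_not_adj hE hij hadj with hI | hI
    · exact collider_of_dSep hij hnik hnjk.symm hik' hjk'.symm (h hI).2.2.2 (hp i hik)
    · exact (collider_of_dSep hij.symm hnjk hnik.symm hjk' hik'.symm (h hI).2.2.2
        (hp j hjk)).symm
  exact ⟨hc.1, hc.2, hij, fun h => hadj ((hS _ _).mpr h)⟩

/-- **Verma–Pearl.** Two DAGs are Markov equivalent if and only if they have the same skeleton
and the same v-structures. -/
theorem markovEquiv_iff_sameSkeleton {p : ℕ} {E E' : Fin p → Fin p → Prop}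
    (hE : Acyclic E) (hE' : Acyclic E') :
    MarkovEquiv E E' ↔ SameSkeleton E E' ∧ VStruct E = VStruct E' := by
  refine ⟨fun h => ?_, fun h => markovEquiv_of_sameSkeleton hE hE' h.1 h.2⟩
  have h₁ : Indep E ⊆ Indep E' := h.subset
  have h₂ : Indep E' ⊆ Indep E := h.superset
  have hS : SameSkeleton E E' := fun _ _ =>
    ⟨adj_of_indep_subset hE' hE h₂, adj_of_indep_subset hE hE' h₁⟩
  exact ⟨hS, (vStruct_subset_of_indep_subset hE hS h₁).antisymm
    (vStruct_subset_of_indep_subset hE' hS.symm h₂)⟩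

/-- `A` has a vertex all of whose companions in `A` are its parents. -/
def HasTerminal (E : V → V → Prop) (A : Finset V) : Prop :=
  ∃ i ∈ A, ∀ a ∈ A, a ≠ i → E a i

theorem charImset_eq_iff {p : ℕ} {E E' : Fin p → Fin p → Prop} {A : Finset (Fin p)} :
    charImset E A = charImset E' A ↔ (HasTerminal E A ↔ HasTerminal E' A) := by
  have h : ∀ F : Fin p → Fin p → Prop,
      (∃ i ∈ A, A \ {i} ⊆ parents F i) ↔ HasTerminal F A := fun F => by
    simp [HasTerminal, parents, Finset.subset_iff]
  simp only [charImset, h]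
  split_ifs <;> simp_all

theorem hasTerminal_pair [DecidableEq V] {i j : V} (hij : i ≠ j) :
    HasTerminal E {i, j} ↔ Adj E i j := by
  simp [HasTerminal, Adj, hij, hij.symm, or_comm]

theorem sameSkeleton_of_hasTerminal [DecidableEq V] (hE : Acyclic E) (hE' : Acyclic E')
    (h : ∀ A : Finset V, 2 ≤ A.card → (HasTerminal E A ↔ HasTerminal E' A)) :
    SameSkeleton E E' := by
  intro i j
  by_cases hij : i = j
  · exact ⟨fun h => absurd hij (hE.ne_of_adj h), fun h => absurd hij (hE'.ne_of_adj h)⟩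
  · rw [← hasTerminal_pair hij, ← hasTerminal_pair hij]
    exact h _ (Finset.card_pair hij).ge

theorem vStruct_subset_of_hasTerminal [DecidableEq V] (hE : Acyclic E)
    (hS : SameSkeleton E E')
    (h : ∀ A : Finset V, 2 ≤ A.card → HasTerminal E A → HasTerminal E' A) :
    VStruct E ⊆ VStruct E' := by
  rintro ⟨i, k, j⟩ ⟨hik, hjk, hij, hadj⟩
  dsimp only at hik hjk hij hadj
  have hnik := hE.ne_of_adj (.inl hik)
  have hnjk := hE.ne_of_adj (.inl hjk)
  have hadj' : ¬ Adj E' i j := fun h => hadj ((hS _ _).mpr h)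
  have hT : HasTerminal E {i, j, k} := ⟨k, by simp, by simp [hik, hjk]⟩
  have hcard : 2 ≤ ({i, j, k} : Finset V).card := by
    rw [Finset.card_eq_three.mpr ⟨i, j, k, hij, hnik, hnjk, rfl⟩]
    omega
  obtain ⟨m, hm, hmp⟩ := h _ hcard hT
  simp only [Finset.mem_insert, Finset.mem_singleton] at hm
  rcases hm with rfl | rfl | rfl
  · exact absurd (.inr (hmp j (by simp) hij.symm)) hadj'
  · exact absurd (.inl (hmp i (by simp) hij)) hadj'
  · exact ⟨hmp i (by simp) hnik, hmp j (by simp) hnjk, hij, hadj'⟩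

theorem HasTerminal.of_sameSkeleton [Finite V] (hE' : Acyclic E')
    (hS : SameSkeleton E E') (hV : VStruct E = VStruct E') {A : Finset V}
    (h : HasTerminal E A) : HasTerminal E' A := by
  obtain ⟨i, hi, hip⟩ := h
  obtain ⟨m, ⟨hmA, hm⟩, hsink⟩ :=
    hE'.exists_sink (S := {c | c ∈ A ∧ (c = i ∨ E' i c)}) ⟨i, hi, .inl rfl⟩
  refine ⟨m, hmA, fun c hc hcm => ?_⟩
  rcases hm with rfl | him
  · exact ((hS _ _).mp (.inl (hip c hc hcm))).resolve_right fun h => hsink c ⟨hc, .inr h⟩ h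
  · by_cases hci : c = i
    · exact hci ▸ him
    have hmi : m ≠ i := (hE'.ne_of_adj (.inl him)).symm
    have hadj : Adj E' c m := by
      by_contra hn
      have : (c, i, m) ∈ VStruct E :=
        ⟨hip c hc hci, hip m hmA hmi, hcm, fun h => hn ((hS _ _).mp h)⟩
      rw [hV] at this
      exact hE'.asymm him this.2.1
    refine hadj.resolve_right fun hmc => ?_
    rcases (hS _ _).mp (.inl (hip c hc hci)) with h | h
    · exact hE'.not_three_cycle him hmc h
    · exact hsink c ⟨hc, .inr h⟩ hmc

end Graph

/-- **Studený–Hemmecke–Lindner.** Two DAGs `G` and `G'` on `Fin p` are Markov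
equivalent if and only if their characteristic imsets agree on every subset `A` of
cardinality at least 2. -/
theorem markovEquiv_iff_charImset_eq {p : ℕ} (G G' : Fin p → Fin p → Prop)
    (hG : Acyclic G) (hG' : Acyclic G') :
    MarkovEquiv G G' ↔
      ∀ A : Finset (Fin p), 2 ≤ A.card → charImset G A = charImset G' A := by
  rw [markovEquiv_iff_sameSkeleton hG hG']
  simp only [charImset_eq_iff]
  constructor
  · rintro ⟨hS, hV⟩ A -
    exact ⟨.of_sameSkeleton hG' hS hV, .of_sameSkeleton hG hS.symm hV.symm⟩
  · intro h
    have hS := sameSkeleton_of_hasTerminal hG hG' h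
    exact ⟨hS, (vStruct_subset_of_hasTerminal hG hS fun A hA => (h A hA).mp).antisymm
      (vStruct_subset_of_hasTerminal hG' hS.symm fun A hA => (h A hA).mpr)⟩

end CausalDiscovery
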